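/- arXiv:1011.5162 — 2 statements merged into one kernel-verified Lean document; each statement's English description precedes it below -/
import Mathlib

section
/- Let $(\Omega, \mathcal{F})$ be a measurable space with a family of probability measures $\{\mathbb{P}_\gamma\}_{\gamma \in \Gamma}$, and let $\mathcal{N}$ be the $\sigma$-field generated by the sets $N \in \mathcal{F}$ with $\mathbb{P}_\gamma(N) = 0$ for all $\gamma \in \Gamma$. Let $\{\mathcal{G}_n\}_{n\ge 1}$ be a countable collection of sufficient sub-$\sigma$-fields of $\mathcal{F}$ such that $\mathcal{N} \subseteq \mathcal{G}_n$ for all $n \ge 1$. Then $\bigcap_{n=1}^{\infty} \mathcal{G}_n$ is a sufficient sub-$\sigma$-field of $\mathcal{F}$. -/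
open MeasureTheory

/-- A sub-σ-field `G` of `m0` is sufficient for the family of probability measures `P`
if for every bounded `m0`-measurable `f` there is a `G`-measurable `g` (integrable for
each `P γ`) with `∫_s f dP γ = ∫_s g dP γ` for all `γ` and all `G`-measurable `s`,
i.e. `g` is a version of `E_γ[f | G]` simultaneously for all `γ`. -/
def IsSufficient {Ω Γ : Type*} (m0 : MeasurableSpace Ω)
    (P : Γ → @Measure Ω m0) (G : MeasurableSpace Ω) : Prop :=
  G ≤ m0 ∧
    ∀ f : Ω → ℝ, Measurable[m0] f → (∃ C : ℝ, ∀ ω, |f ω| ≤ C) →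
      ∃ g : Ω → ℝ, Measurable[G] g ∧ (∀ γ, Integrable g (P γ)) ∧
        ∀ γ, ∀ s : Set Ω, MeasurableSet[G] s →
          ∫ ω in s, f ω ∂(P γ) = ∫ ω in s, g ω ∂(P γ)

open Filter Topology Finset
open scoped ENNReal RealInnerProductSpace

section L2

variable {Ω : Type*} [MeasurableSpace Ω] {μ : Measure Ω} [IsProbabilityMeasure μ]

theorem inner_const_one_Lp (f : Lp ℝ 2 μ) :
    ⟪Lp.const 2 μ (1 : ℝ), f⟫ = ∫ ω, f ω ∂μ := by
  rw [← indicatorConstLp_univ, L2.inner_indicatorConstLp_one, setIntegral_univ]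

theorem integral_abs_Lp_le_norm (f : Lp ℝ 2 μ) : ∫ ω, |f ω| ∂μ ≤ ‖f‖ := by
  have h1 : ∫ ω, |f ω| ∂μ = ⟪Lp.const 2 μ (1 : ℝ), |f|⟫ := by
    rw [inner_const_one_Lp]
    exact integral_congr_ae (Lp.coeFn_abs f).symm
  rw [h1]
  refine (real_inner_le_norm _ _).trans ?_
  have : ‖Lp.const 2 μ (1 : ℝ)‖ ≤ 1 := by
    simpa using Lp.norm_const_le (p := 2) (μ := μ) (c := (1 : ℝ))
  rw [norm_abs_eq_norm]
  exact mul_le_of_le_one_left (norm_nonneg _) this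

end L2

/-- A self-adjoint Markov operator on `L²`: a positive symmetric contraction fixing constants. -/
structure IsSymmMarkov {Ω : Type*} [MeasurableSpace Ω] {μ : Measure Ω} [IsFiniteMeasure μ]
    (T : Lp ℝ 2 μ →L[ℝ] Lp ℝ 2 μ) : Prop where
  nonneg : ∀ f, 0 ≤ f → 0 ≤ T f
  symm : ∀ f g, ⟪T f, g⟫ = ⟪f, T g⟫
  map_const : ∀ c : ℝ, T (Lp.const 2 μ c) = Lp.const 2 μ c
  norm_le : ‖T‖ ≤ 1

namespace IsSymmMarkov

variable {Ω : Type*} [MeasurableSpace Ω] {μ : Measure Ω} [IsProbabilityMeasure μ]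
  {T : Lp ℝ 2 μ →L[ℝ] Lp ℝ 2 μ}

theorem mono (hT : IsSymmMarkov T) {f g : Lp ℝ 2 μ} (h : f ≤ g) : T f ≤ T g := by
  have := hT.nonneg (g - f) (sub_nonneg.2 h)
  rwa [map_sub, sub_nonneg] at this

theorem integral_map (hT : IsSymmMarkov T) (f : Lp ℝ 2 μ) : ∫ ω, T f ω ∂μ = ∫ ω, f ω ∂μ := by
  rw [← inner_const_one_Lp, ← inner_const_one_Lp, ← hT.symm, hT.map_const]

theorem norm_map_le (hT : IsSymmMarkov T) (f : Lp ℝ 2 μ) : ‖T f‖ ≤ ‖f‖ :=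
  (T.le_of_opNorm_le hT.norm_le f).trans (one_mul _).le

theorem norm_pow_apply_le (hT : IsSymmMarkov T) (k : ℕ) (f : Lp ℝ 2 μ) :
    ‖(T ^ k) f‖ ≤ ‖f‖ := by
  induction k with
  | zero => simp
  | succ k ih =>
    rw [pow_succ']
    exact (hT.norm_map_le _).trans ih

theorem pow_map_const (hT : IsSymmMarkov T) (k : ℕ) (c : ℝ) :
    (T ^ k) (Lp.const 2 μ c) = Lp.const 2 μ c := by
  induction k with
  | zero => simp
  | succ k ih =>
    rw [pow_succ']
    change T ((T ^ k) _) = _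
    rw [ih, hT.map_const]

theorem abs_pow_apply_le (hT : IsSymmMarkov T) (k : ℕ) (f : Lp ℝ 2 μ) :
    |(T ^ k) f| ≤ (T ^ k) |f| := by
  induction k with
  | zero => simp
  | succ k ih =>
    rw [pow_succ']
    change |T ((T ^ k) _)| ≤ T ((T ^ k) _)
    rw [abs_le'] at ih ⊢
    refine ⟨hT.mono ih.1, ?_⟩
    rw [← map_neg]
    exact hT.mono ih.2

/-- The maximal ergodic inequality of Hopf, in the form due to Garsia. -/
theorem setIntegral_partialSups_nonneg (hT : IsSymmMarkov T) (g : Lp ℝ 2 μ) (n : ℕ) :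
    0 ≤ ∫ ω in {ω | 0 < (partialSups (fun k => (∑ i ∈ range k, T ^ i) g) n : Lp ℝ 2 μ) ω},
      g ω ∂μ := by
  set S : ℕ → Lp ℝ 2 μ := fun k => (∑ i ∈ range k, T ^ i) g with hS
  set M : Lp ℝ 2 μ := partialSups S n with hM
  have hM0 : 0 ≤ M := by
    have h := le_partialSups_of_le S (Nat.zero_le n)
    have hS0 : S 0 = 0 := by simp [hS]
    rwa [hS0] at h
  have hTM : 0 ≤ T M := hT.nonneg _ hM0
  have hsup : M ≤ (g + T M) ⊔ 0 := by
    refine partialSups_le _ _ _ fun k hk => ?_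
    rcases k with _ | j
    · simp [hS]
    · refine le_sup_of_le_left ?_
      have h1 : S (j + 1) = g + T (S j) := by
        simp only [hS, sum_range_succ', pow_succ', ← mul_sum]
        simp [add_comm]
      rw [h1]
      gcongr
      exact hT.mono (le_partialSups_of_le S (by omega))
  have hmeas : MeasurableSet {ω | 0 < M ω} :=
    (Lp.stronglyMeasurable M).measurable measurableSet_Ioi
  rw [← integral_indicator hmeas]
  have hint : ∀ f : Lp ℝ 2 μ, Integrable f μ := fun f =>
    (Lp.memLp f).integrable one_le_two
  have h0 : ∫ ω, (M ω - T M ω) ∂μ = 0 := by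
    rw [integral_sub (hint _) (hint _), hT.integral_map, sub_self]
  refine h0.symm.trans_le (integral_mono_ae ((hint _).sub (hint _)) ((hint g).indicator hmeas) ?_)
  filter_upwards [(Lp.coeFn_le _ _).2 hsup, Lp.coeFn_sup (g + T M) 0, Lp.coeFn_add g (T M),
    Lp.coeFn_zero ℝ 2 μ, (Lp.coeFn_le _ _).2 hTM] with ω h1 h2 h3 h4 h5
  rw [h2, Pi.sup_apply, h3, h4] at h1
  rw [h4] at h5
  simp only [Pi.add_apply, Pi.zero_apply] at h1 h5
  by_cases hω : 0 < M ω
  · rw [Set.indicator_of_mem (by exact hω)]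
    rcases le_sup_iff.1 h1 with h | h <;> linarith
  · rw [Set.indicator_of_notMem (by exact hω)]
    linarith

theorem measureReal_maximal_le (hT : IsSymmMarkov T) (f : Lp ℝ 2 μ) {c : ℝ} (hc : 0 < c) (n : ℕ) :
    μ.real {ω | ∃ k ≤ n, k * c < |(∑ i ∈ range k, T ^ i) f ω|} ≤ ‖f‖ / c := by
  set g : Lp ℝ 2 μ := |f| - Lp.const 2 μ c with hg
  set S : ℕ → Lp ℝ 2 μ := fun k => (∑ i ∈ range k, T ^ i) g with hS
  set M : Lp ℝ 2 μ := partialSups S n with hM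
  have hint : ∀ f : Lp ℝ 2 μ, Integrable f μ := fun f =>
    (Lp.memLp f).integrable one_le_two
  have hmeas : MeasurableSet {ω | 0 < M ω} :=
    (Lp.stronglyMeasurable M).measurable measurableSet_Ioi
  have key := hT.setIntegral_partialSups_nonneg g n
  have hgae : g =ᵐ[μ] fun ω => |f ω| - c := by
    filter_upwards [Lp.coeFn_sub |f| (Lp.const 2 μ c), Lp.coeFn_abs f,
      Lp.coeFn_const (p := 2) (μ := μ) c] with ω h1 h2 h3
    rw [hg, h1, Pi.sub_apply, h2, h3]
    rfl
  have hgint : ∫ ω in {ω | 0 < M ω}, g ω ∂μ ≤ ‖f‖ - c * μ.real {ω | 0 < M ω} := by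
    rw [integral_congr_ae (ae_restrict_of_ae hgae),
      integral_sub (hint f).abs.integrableOn (integrable_const c).integrableOn]
    have h1 := setIntegral_le_integral (μ := μ) (s := {ω | 0 < M ω}) (hint f).abs
      (Eventually.of_forall fun ω => abs_nonneg _)
    have h2 := integral_abs_Lp_le_norm f
    simp only [integral_const, measureReal_restrict_apply_univ, smul_eq_mul]
    linarith [mul_comm c (μ.real {ω | 0 < M ω})]
  have hle : μ.real {ω | 0 < M ω} ≤ ‖f‖ / c := by
    rw [le_div_iff₀ hc]
    linarith [mul_comm c (μ.real {ω | 0 < M ω})]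
  refine le_trans ?_ hle
  refine ENNReal.toReal_mono (measure_ne_top _ _) (measure_mono_ae ?_)
  have hSk : ∀ k, |(∑ i ∈ range k, T ^ i) f| - Lp.const 2 μ (k * c) ≤ S k := by
    intro k
    have e1 : S k = (∑ i ∈ range k, (T ^ i) |f|) - Lp.const 2 μ (k * c) := by
      simp only [hS, hg, map_sub, _root_.sum_apply, hT.pow_map_const, sum_const,
        card_range, ← map_nsmul, nsmul_eq_mul]
    rw [e1, _root_.sum_apply]
    gcongr
    have habs := fun i => abs_le'.1 (hT.abs_pow_apply_le i f)
    refine abs_le'.2 ⟨sum_le_sum fun i _ => (habs i).1, ?_⟩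
    rw [← sum_neg_distrib]
    exact sum_le_sum fun i _ => (habs i).2
  have hall : ∀ᵐ ω ∂μ, ∀ k ≤ n, |(∑ i ∈ range k, T ^ i) f ω| - k * c ≤ M ω := by
    refine ae_all_iff.2 fun k => ?_
    by_cases hk : k ≤ n
    swap
    · exact Eventually.of_forall fun _ h => absurd h hk
    filter_upwards [(Lp.coeFn_le _ _).2 ((hSk k).trans (le_partialSups_of_le S hk)),
      Lp.coeFn_sub |(∑ i ∈ range k, T ^ i) f| (Lp.const 2 μ (k * c)),
      Lp.coeFn_abs ((∑ i ∈ range k, T ^ i) f),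
      Lp.coeFn_const (p := 2) (μ := μ) (k * c)] with ω h1 h2 h3 h4 _
    rw [h2, Pi.sub_apply, h3, h4] at h1
    exact h1
  filter_upwards [hall] with ω h ⟨k, hk, hlt⟩
  have := h k hk
  change 0 < M ω
  linarith

theorem measure_maximal_le (hT : IsSymmMarkov T) (f : Lp ℝ 2 μ) {c : ℝ} (hc : 0 < c) :
    μ {ω | ∃ k : ℕ, k * c < |(∑ i ∈ range k, T ^ i) f ω|} ≤ ENNReal.ofReal (‖f‖ / c) := by
  have : {ω | ∃ k : ℕ, k * c < |(∑ i ∈ range k, T ^ i) f ω|} =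
      ⋃ n : ℕ, {ω | ∃ k ≤ n, k * c < |(∑ i ∈ range k, T ^ i) f ω|} := by
    ext ω
    simp only [Set.mem_ofPred_eq, Set.mem_iUnion]
    exact ⟨fun ⟨k, hk⟩ => ⟨k, k, le_rfl, hk⟩, fun ⟨_, k, _, hk⟩ => ⟨k, hk⟩⟩
  rw [this, Monotone.measure_iUnion]
  · refine iSup_le fun n => ?_
    rw [← ofReal_measureReal]
    exact ENNReal.ofReal_le_ofReal (hT.measureReal_maximal_le f hc n)
  · rintro n m hnm ω ⟨k, hk, h⟩
    exact ⟨k, hk.trans hnm, h⟩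

theorem ae_tendsto_pow_apply_div (hT : IsSymmMarkov T) (h : Lp ℝ 2 μ) :
    ∀ᵐ ω ∂μ, Tendsto (fun k : ℕ => (T ^ k) h ω / k) atTop (𝓝 0) := by
  have hmeas : ∀ k : ℕ, Measurable fun ω => ENNReal.ofReal (((T ^ k) h ω / k) ^ 2) := fun k =>
    ((((Lp.stronglyMeasurable ((T ^ k) h)).measurable.div_const _).pow_const 2)).ennreal_ofReal
  have hbound : ∀ k : ℕ, ∫⁻ ω, ENNReal.ofReal (((T ^ k) h ω / k) ^ 2) ∂μ ≤
      ENNReal.ofReal (‖h‖ ^ 2 * (1 / (k : ℝ) ^ 2)) := by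
    intro k
    have hi : Integrable (fun ω => ((T ^ k) h ω / k) ^ 2) μ := by
      simp only [div_pow]
      exact (Lp.memLp ((T ^ k) h)).integrable_sq.div_const _
    rw [← ofReal_integral_eq_lintegral_ofReal hi (Eventually.of_forall fun ω => sq_nonneg _)]
    refine ENNReal.ofReal_le_ofReal ?_
    simp only [div_pow, integral_div]
    rw [mul_one_div]
    gcongr
    have : ∫ ω, (T ^ k) h ω ^ 2 ∂μ = ‖(T ^ k) h‖ ^ 2 := by
      rw [← real_inner_self_eq_norm_sq, L2.inner_def]
      simp [sq]
    rw [this]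
    gcongr
    exact hT.norm_pow_apply_le k h
  have hsum : ∫⁻ ω, ∑' k : ℕ, ENNReal.ofReal (((T ^ k) h ω / k) ^ 2) ∂μ ≠ ∞ := by
    rw [lintegral_tsum fun k => (hmeas k).aemeasurable]
    refine ne_top_of_le_ne_top ?_ (ENNReal.tsum_le_tsum hbound)
    have hs : Summable fun k : ℕ => ‖h‖ ^ 2 * (1 / (k : ℝ) ^ 2) :=
      (Real.summable_one_div_nat_pow.2 one_lt_two).mul_left _
    rw [← ENNReal.ofReal_tsum_of_nonneg (fun k => by positivity) hs]
    exact ENNReal.ofReal_ne_top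
  filter_upwards [ae_lt_top (Measurable.tsum hmeas) hsum] with ω hω
  have h1 := ENNReal.tendsto_atTop_zero_of_tsum_ne_top hω.ne
  have h2 := (ENNReal.tendsto_toReal ENNReal.zero_ne_top).comp h1
  simp only [Function.comp_def, ENNReal.toReal_ofReal (sq_nonneg _), ENNReal.toReal_zero] at h2
  have h3 := h2.sqrt
  simp only [Real.sqrt_sq_eq_abs, Real.sqrt_zero] at h3
  exact (tendsto_zero_iff_abs_tendsto_zero _).2 h3

/-- The pointwise ergodic theorem for self-adjoint Markov operators on `L²`. -/
theorem ae_tendsto_average (hT : IsSymmMarkov T) (f : Lp ℝ 2 μ) :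
    ∀ᵐ ω ∂μ, Tendsto (fun k : ℕ => (k : ℝ)⁻¹ * (∑ i ∈ range k, T ^ i) f ω) atTop
      (𝓝 (((T.eqLocus (1 : Lp ℝ 2 μ →L[ℝ] Lp ℝ 2 μ)).orthogonalProjectionOnto f :
        Lp ℝ 2 μ) ω)) := by
  set p : Lp ℝ 2 μ :=
    ((T.eqLocus (1 : Lp ℝ 2 μ →L[ℝ] Lp ℝ 2 μ)).orthogonalProjectionOnto f : Lp ℝ 2 μ) with hp
  have hTp : T p = p :=
    ((T.eqLocus (1 : Lp ℝ 2 μ →L[ℝ] Lp ℝ 2 μ)).orthogonalProjectionOnto f).2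
  have hpow : ∀ i : ℕ, (T ^ i) p = p := by
    intro i
    induction i with
    | zero => simp
    | succ i ih =>
      rw [pow_succ']
      change T ((T ^ i) p) = p
      rw [ih, hTp]
  have hmean : Tendsto (fun n : ℕ => (n : ℝ)⁻¹ • (∑ i ∈ range n, T ^ i) f) atTop (𝓝 p) := by
    have e : ∀ n : ℕ, (n : ℝ)⁻¹ • (∑ i ∈ range n, T ^ i) f = birkhoffAverage ℝ T id n f := by
      simp [birkhoffAverage, birkhoffSum]
    simp only [e]
    exact T.tendsto_birkhoffAverage_orthogonalProjection hT.norm_le f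
  have hcob : ∀ n : ℕ, n ≠ 0 → ∃ h, f - (n : ℝ)⁻¹ • (∑ i ∈ range n, T ^ i) f = h - T h := by
    intro n hn
    have hr : ∀ i : ℕ, f - (T ^ i) f ∈ LinearMap.range ((1 - T : Lp ℝ 2 μ →L[ℝ] Lp ℝ 2 μ) :
        Lp ℝ 2 μ →ₗ[ℝ] Lp ℝ 2 μ) := by
      intro i
      refine ⟨(∑ j ∈ range i, T ^ j) f, ?_⟩
      change ((1 - T) * ∑ j ∈ range i, T ^ j) f = _
      rw [mul_neg_geom_sum]
      rfl
    have hs := Submodule.smul_mem _ ((n : ℝ)⁻¹)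
      (Submodule.sum_mem _ fun i (_ : i ∈ range n) => hr i)
    obtain ⟨h, hh⟩ := hs
    refine ⟨h, ?_⟩
    have hn' : (n : ℝ) ≠ 0 := by exact_mod_cast hn
    have : h - T h = (n : ℝ)⁻¹ • ∑ i ∈ range n, (f - (T ^ i) f) := hh
    rw [this, sum_sub_distrib, smul_sub, _root_.sum_apply, sum_const, card_range,
      ← Nat.cast_smul_eq_nsmul ℝ, smul_smul, inv_mul_cancel₀ hn', one_smul]
  have hnull : ∀ c : ℝ, 0 < c → ∀ᵐ ω ∂μ, ∀ᶠ k : ℕ in atTop,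
      |(k : ℝ)⁻¹ * (∑ i ∈ range k, T ^ i) f ω - p ω| ≤ c := by
    intro c hc
    rw [ae_iff]
    refine le_antisymm (le_of_forall_pos_le_add fun ε hε => ?_) zero_le
    rw [zero_add]
    obtain ⟨δ, hδ, hδε⟩ : ∃ δ : ℝ, 0 < δ ∧ ENNReal.ofReal (δ / (c / 2)) ≤ ε := by
      have : Tendsto (fun δ : ℝ => ENNReal.ofReal (δ / (c / 2))) (𝓝[>] 0) (𝓝 0) := by
        have h : Tendsto (fun δ : ℝ => ENNReal.ofReal (δ / (c / 2))) (𝓝 0)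
            (𝓝 (ENNReal.ofReal (0 / (c / 2)))) := by
          refine ENNReal.tendsto_ofReal (Tendsto.div_const tendsto_id _)
        simp only [zero_div, ENNReal.ofReal_zero] at h
        exact h.mono_left nhdsWithin_le_nhds
      obtain ⟨δ, h1, h2⟩ := ((this.eventually (ge_mem_nhds hε)).and self_mem_nhdsWithin).exists
      exact ⟨δ, h2, h1⟩
    obtain ⟨n, hn, hn0⟩ := ((hmean.eventually (Metric.ball_mem_nhds p hδ)).and
      (eventually_ne_atTop 0)).exists
    set q : Lp ℝ 2 μ := (n : ℝ)⁻¹ • (∑ i ∈ range n, T ^ i) f with hq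
    obtain ⟨h, hh⟩ := hcob n hn0
    set r : Lp ℝ 2 μ := q - p with hr
    have hrn : ‖r‖ ≤ δ := by
      have := Metric.mem_ball.1 hn
      rw [dist_eq_norm] at this
      exact this.le
    refine le_trans ?_ ((hT.measure_maximal_le r (half_pos hc)).trans
      ((ENNReal.ofReal_le_ofReal (by gcongr)).trans hδε))
    refine measure_mono_ae ?_
    have hdec : ∀ k : ℕ, (∑ i ∈ range k, T ^ i) f =
        (k : ℝ) • p + (h - (T ^ k) h) + (∑ i ∈ range k, T ^ i) r := by
      intro k
      have e : f = p + (h - T h) + r := by rw [← hh, hr]; abel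
      have e2 : (∑ i ∈ range k, T ^ i) (h - T h) = h - (T ^ k) h := by
        change ((∑ i ∈ range k, T ^ i) * (1 - T)) h = _
        rw [geom_sum_mul_neg]
        rfl
      conv_lhs => rw [e]
      rw [map_add, map_add, e2, _root_.sum_apply, sum_congr rfl fun i _ => hpow i,
        sum_const, card_range, Nat.cast_smul_eq_nsmul]
    have hdec' : ∀ᵐ ω ∂μ, ∀ k : ℕ, (∑ i ∈ range k, T ^ i) f ω =
        k * p ω + (h ω - (T ^ k) h ω) + (∑ i ∈ range k, T ^ i) r ω := by
      refine ae_all_iff.2 fun k => ?_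
      filter_upwards [Lp.coeFn_add ((k : ℝ) • p + (h - (T ^ k) h)) ((∑ i ∈ range k, T ^ i) r),
        Lp.coeFn_add ((k : ℝ) • p) (h - (T ^ k) h), Lp.coeFn_smul (k : ℝ) p,
        Lp.coeFn_sub h ((T ^ k) h)] with ω h1 h2 h3 h4
      rw [hdec k, h1, Pi.add_apply, h2, Pi.add_apply, h3, h4]
      rfl
    filter_upwards [hdec', hT.ae_tendsto_pow_apply_div h] with ω h1 h2 hfreq
    change ¬ _ at hfreq
    change ∃ k : ℕ, _
    by_contra! hcon
    refine hfreq ?_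
    have h3 : Tendsto (fun k : ℕ => h ω / k - (T ^ k) h ω / k) atTop (𝓝 (0 - 0)) :=
      (tendsto_const_div_atTop_nhds_zero_nat _).sub h2
    rw [sub_zero] at h3
    have h4 := (tendsto_zero_iff_abs_tendsto_zero _).1 h3
    filter_upwards [h4.eventually (ge_mem_nhds (half_pos hc)), eventually_gt_atTop 0]
      with k hk hk0
    have hk0' : (0 : ℝ) < k := by exact_mod_cast hk0
    have e : (k : ℝ)⁻¹ * (∑ i ∈ range k, T ^ i) f ω - p ω =
        (h ω / k - (T ^ k) h ω / k) + (∑ i ∈ range k, T ^ i) r ω / k := by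
      rw [h1 k]
      field_simp
      ring
    rw [e]
    refine (abs_add_le _ _).trans ?_
    have h5 : |(∑ i ∈ range k, T ^ i) r ω / k| ≤ c / 2 := by
      rw [abs_div, abs_of_pos hk0', div_le_iff₀ hk0', mul_comm]
      exact hcon k
    simp only [Function.comp_apply] at hk
    linarith
  have hall : ∀ᵐ ω ∂μ, ∀ m : ℕ, ∀ᶠ k : ℕ in atTop,
      |(k : ℝ)⁻¹ * (∑ i ∈ range k, T ^ i) f ω - p ω| ≤ 1 / ((m : ℝ) + 1) :=
    ae_all_iff.2 fun m => hnull _ Nat.one_div_pos_of_nat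
  filter_upwards [hall] with ω hω
  refine Metric.tendsto_nhds.2 fun ε hε => ?_
  obtain ⟨m, hm⟩ := exists_nat_one_div_lt hε
  filter_upwards [hω m] with k hk
  rw [Real.dist_eq]
  exact hk.trans_lt hm

end IsSymmMarkov

section CondExpLp

variable {Ω : Type*} {m m0 : MeasurableSpace Ω} {μ : Measure Ω}

/-- Conditional expectation as an operator on `L²`. -/
noncomputable def condExpLp (μ : Measure Ω) (hm : m ≤ m0) : Lp ℝ 2 μ →L[ℝ] Lp ℝ 2 μ :=
  (lpMeas ℝ ℝ m 2 μ).subtypeL ∘L condExpL2 ℝ ℝ hm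

theorem inner_sub_condExpLp_self (hm : m ≤ m0) (f : Lp ℝ 2 μ) :
    ⟪f - condExpLp μ hm f, f⟫ = ‖f - condExpLp μ hm f‖ ^ 2 := by
  have h : ⟪condExpLp μ hm f, condExpLp μ hm f⟫ = ⟪f, condExpLp μ hm f⟫ :=
    inner_condExpL2_eq_inner_fun hm f (condExpLp μ hm f) (aestronglyMeasurable_condExpL2 hm f)
  rw [← real_inner_self_eq_norm_sq]
  simp only [inner_sub_left, inner_sub_right, h]
  rw [real_inner_comm f]
  ring

variable [IsProbabilityMeasure μ]

theorem condExpLp_toLp_ae_eq (hm : m ≤ m0) {f : Ω → ℝ} (hf : MemLp f 2 μ) :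
    condExpLp μ hm hf.toLp =ᵐ[μ] μ[f | m] :=
  hf.condExpL2_ae_eq_condExp hm

theorem condExpLp_ae_eq (hm : m ≤ m0) (f : Lp ℝ 2 μ) : condExpLp μ hm f =ᵐ[μ] μ[f | m] := by
  simpa only [Lp.toLp_coeFn] using condExpLp_toLp_ae_eq hm (Lp.memLp f)

theorem condExpLp_indicatorConstLp (hm : m ≤ m0) {s : Set Ω} (hs : MeasurableSet[m] s) (c : ℝ) :
    condExpLp μ hm (indicatorConstLp 2 (hm s hs) (measure_ne_top μ s) c) =
      indicatorConstLp 2 (hm s hs) (measure_ne_top μ s) c :=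
  condExpL2_indicator_of_measurable hm hs (measure_ne_top μ s) c

theorem isSymmMarkov_condExpLp (hm : m ≤ m0) : IsSymmMarkov (condExpLp μ hm) where
  nonneg f hf := by
    rw [← Lp.coeFn_nonneg] at hf ⊢
    filter_upwards [condExp_nonneg (m := m) hf, condExpLp_ae_eq hm f] with ω h1 h2
    rwa [h2]
  symm f g := inner_condExpL2_left_eq_right hm
  map_const c := by
    rw [← indicatorConstLp_univ]
    exact condExpLp_indicatorConstLp hm MeasurableSet.univ c
  norm_le := ContinuousLinearMap.opNorm_le_bound _ zero_le_one fun f => by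
    rw [one_mul]
    exact norm_condExpL2_coe_le hm f

end CondExpLp

section AvgCondExp

variable {Ω : Type*} {G : ℕ → MeasurableSpace Ω} {m0 : MeasurableSpace Ω} {μ : Measure Ω}
  [IsProbabilityMeasure μ]

/-- A weighted average of the conditional expectations given countably many sub-σ-fields. -/
noncomputable def avgCondExp (μ : Measure Ω) (hG : ∀ n, G n ≤ m0) : Lp ℝ 2 μ →L[ℝ] Lp ℝ 2 μ :=
  ∑' n : ℕ, ((1 : ℝ) / 2 / 2 ^ n) • condExpLp μ (hG n)

theorem hasSum_avgCondExp (hG : ∀ n, G n ≤ m0) :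
    HasSum (fun n : ℕ => ((1 : ℝ) / 2 / 2 ^ n) • condExpLp μ (hG n)) (avgCondExp μ hG) := by
  refine (Summable.of_norm_bounded (summable_geometric_two' 1) fun n => ?_).hasSum
  rw [norm_smul, Real.norm_of_nonneg (by positivity)]
  exact mul_le_of_le_one_right (by positivity) (isSymmMarkov_condExpLp (hG n)).norm_le

theorem hasSum_avgCondExp_apply (hG : ∀ n, G n ≤ m0) (f : Lp ℝ 2 μ) :
    HasSum (fun n : ℕ => ((1 : ℝ) / 2 / 2 ^ n) • condExpLp μ (hG n) f) (avgCondExp μ hG f) :=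
  (hasSum_avgCondExp hG).mapL (ContinuousLinearMap.apply ℝ (Lp ℝ 2 μ) f)

theorem avgCondExp_eq_self (hG : ∀ n, G n ≤ m0) {f : Lp ℝ 2 μ}
    (h : ∀ n, condExpLp μ (hG n) f = f) : avgCondExp μ hG f = f := by
  have h1 := hasSum_avgCondExp_apply hG f
  simp only [h] at h1
  have h2 := (hasSum_geometric_two' 1).smul_const f
  rw [one_smul] at h2
  exact h1.unique h2

theorem isSymmMarkov_avgCondExp (hG : ∀ n, G n ≤ m0) : IsSymmMarkov (avgCondExp μ hG) where
  nonneg f hf := (hasSum_avgCondExp_apply hG f).nonneg fun n => by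
    have h := (isSymmMarkov_condExpLp (hG n)).nonneg f hf
    rw [← Lp.coeFn_nonneg] at h ⊢
    filter_upwards [h, Lp.coeFn_smul ((1 : ℝ) / 2 / 2 ^ n) (condExpLp μ (hG n) f)] with ω h1 h2
    rw [h2]
    exact mul_nonneg (by positivity) h1
  symm f g := by
    have h1 := (hasSum_avgCondExp_apply hG f).mapL (innerSL ℝ g)
    have h2 := (hasSum_avgCondExp_apply hG g).mapL (innerSL ℝ f)
    have e : ∀ n : ℕ, ⟪g, ((1 : ℝ) / 2 / 2 ^ n) • condExpLp μ (hG n) f⟫ =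
        ⟪f, ((1 : ℝ) / 2 / 2 ^ n) • condExpLp μ (hG n) g⟫ := fun n => by
      rw [real_inner_smul_right, real_inner_smul_right,
        ← (isSymmMarkov_condExpLp (hG n)).symm f g, real_inner_comm]
    simp only [innerSL_apply_apply, e] at h1 h2
    rw [real_inner_comm]
    exact h1.unique h2
  map_const c := avgCondExp_eq_self hG fun n => (isSymmMarkov_condExpLp (hG n)).map_const c
  norm_le := by
    refine (hasSum_avgCondExp hG).norm_le_of_bounded (hasSum_geometric_two' 1) fun n => ?_
    rw [norm_smul, Real.norm_of_nonneg (by positivity)]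
    exact mul_le_of_le_one_right (by positivity) (isSymmMarkov_condExpLp (hG n)).norm_le

theorem condExpLp_eq_self_of_avgCondExp_eq_self (hG : ∀ n, G n ≤ m0) {f : Lp ℝ 2 μ}
    (h : avgCondExp μ hG f = f) (n : ℕ) : condExpLp μ (hG n) f = f := by
  have h1 := hasSum_avgCondExp_apply hG f
  have h2 := (hasSum_geometric_two' 1).smul_const f
  have h3 := (h2.sub h1).mapL (innerSL ℝ f)
  have e : ∀ n : ℕ, ⟪f, ((1 : ℝ) / 2 / 2 ^ n) • f - ((1 : ℝ) / 2 / 2 ^ n) • condExpLp μ (hG n) f⟫ =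
      ((1 : ℝ) / 2 / 2 ^ n) * ‖f - condExpLp μ (hG n) f‖ ^ 2 := fun n => by
    rw [← smul_sub, real_inner_smul_right, real_inner_comm, inner_sub_condExpLp_self]
  simp only [innerSL_apply_apply, e, h, one_smul, sub_self, map_zero] at h3
  rw [hasSum_zero_iff_of_nonneg fun n => by positivity] at h3
  have h4 := congrFun h3 n
  simp only [Pi.zero_apply, mul_eq_zero] at h4
  rcases h4 with h4 | h4
  · exact absurd h4 (by positivity)
  · exact (sub_eq_zero.1 (norm_eq_zero.1 (pow_eq_zero_iff two_ne_zero |>.1 h4))).symm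

theorem toLp_tsum_eq_avgCondExp (hG : ∀ n, G n ≤ m0) {f : Ω → ℝ} (hf : MemLp f 2 μ)
    {t : ℕ → Ω → ℝ} {C : ℝ} (ht : ∀ n, t n =ᵐ[μ] μ[f | G n]) (htC : ∀ n ω, |t n ω| ≤ C) :
    (fun ω => ∑' n, ((1 : ℝ) / 2 / 2 ^ n) * t n ω) =ᵐ[μ] avgCondExp μ hG hf.toLp := by
  have hlim := (hasSum_avgCondExp_apply hG hf.toLp).tendsto_sum_nat
  obtain ⟨φ, hφ, hae⟩ := (tendstoInMeasure_of_tendsto_Lp hlim).exists_seq_tendsto_ae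
  have hsum : ∀ᵐ ω ∂μ, ∀ k : ℕ,
      (∑ n ∈ range k, ((1 : ℝ) / 2 / 2 ^ n) • condExpLp μ (hG n) hf.toLp : Lp ℝ 2 μ) ω =
        ∑ n ∈ range k, ((1 : ℝ) / 2 / 2 ^ n) * t n ω := by
    refine ae_all_iff.2 fun k => ?_
    induction k with
    | zero =>
      simp
    | succ k ih =>
      rw [sum_range_succ]
      filter_upwards [ih, Lp.coeFn_add
        (∑ n ∈ range k, ((1 : ℝ) / 2 / 2 ^ n) • condExpLp μ (hG n) hf.toLp)
        (((1 : ℝ) / 2 / 2 ^ k) • condExpLp μ (hG k) hf.toLp),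
        Lp.coeFn_smul ((1 : ℝ) / 2 / 2 ^ k) (condExpLp μ (hG k) hf.toLp),
        condExpLp_toLp_ae_eq (hG k) hf, ht k] with ω h1 h2 h3 h4 h5
      rw [h2, Pi.add_apply, h1, h3, Pi.smul_apply, h4, ← h5, sum_range_succ, smul_eq_mul]
  filter_upwards [hae, hsum] with ω h1 h2
  simp only [h2] at h1
  have hs : Summable fun n => ((1 : ℝ) / 2 / 2 ^ n) * t n ω := by
    refine Summable.of_norm_bounded ((summable_geometric_two' 1).mul_right C) fun n => ?_
    rw [norm_mul, Real.norm_of_nonneg (by positivity)]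
    gcongr
    exact htC n ω
  exact tendsto_nhds_unique (hs.hasSum.tendsto_sum_nat.comp hφ.tendsto_atTop) h1

/-- Cesàro averages of iterates of averaged conditional expectations converge almost everywhere
to a function fixed by all the conditional expectations. -/
theorem exists_ae_tendsto_average_iterates (hG : ∀ n, G n ≤ m0) {F : ℕ → Ω → ℝ}
    {t : ℕ → ℕ → Ω → ℝ} {C : ℝ} (hF : ∀ k, Measurable (F k)) (hFC : ∀ k ω, |F k ω| ≤ C)
    (ht : ∀ k n, t k n =ᵐ[μ] μ[F k | G n]) (htC : ∀ k n ω, |t k n ω| ≤ C)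
    (hsucc : ∀ k ω, F (k + 1) ω = ∑' n, ((1 : ℝ) / 2 / 2 ^ n) * t k n ω) :
    ∃ p : Lp ℝ 2 μ,
      (∀ᵐ ω ∂μ, Tendsto (fun k : ℕ => (k : ℝ)⁻¹ * ∑ i ∈ range k, F i ω) atTop (𝓝 (p ω))) ∧
      (∀ n, condExpLp μ (hG n) p = p) ∧
      ∀ s, MeasurableSet[⨅ n, G n] s → ∫ ω in s, F 0 ω ∂μ = ∫ ω in s, p ω ∂μ := by
  set T := avgCondExp μ hG with hT
  have hTM : IsSymmMarkov T := isSymmMarkov_avgCondExp hG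
  have hmem : ∀ k, MemLp (F k) 2 μ := fun k =>
    MemLp.of_bound (hF k).aestronglyMeasurable C (Eventually.of_forall (hFC k))
  have hiter : ∀ k, (hmem k).toLp = (T ^ k) (hmem 0).toLp := by
    intro k
    induction k with
    | zero => simp
    | succ k ih =>
      rw [pow_succ']
      change _ = T ((T ^ k) _)
      rw [← ih]
      refine Lp.ext ?_
      filter_upwards [(hmem (k + 1)).coeFn_toLp,
        toLp_tsum_eq_avgCondExp hG (hmem k) (ht k) (htC k)] with ω h1 h2
      rw [h1, hsucc, h2]
  set P := (T.eqLocus (1 : Lp ℝ 2 μ →L[ℝ] Lp ℝ 2 μ)) with hP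
  refine ⟨P.orthogonalProjectionOnto (hmem 0).toLp, ?_, ?_, ?_⟩
  · have hsum : ∀ᵐ ω ∂μ, ∀ k : ℕ,
        (∑ i ∈ range k, T ^ i) (hmem 0).toLp ω = ∑ i ∈ range k, F i ω := by
      refine ae_all_iff.2 fun k => ?_
      induction k with
      | zero =>
        simp
      | succ k ih =>
        rw [sum_range_succ, add_apply, ← hiter]
        filter_upwards [ih, Lp.coeFn_add ((∑ i ∈ range k, T ^ i) (hmem 0).toLp) (hmem k).toLp,
          (hmem k).coeFn_toLp] with ω h1 h2 h3
        rw [h2, Pi.add_apply, h1, h3, sum_range_succ]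
    filter_upwards [hTM.ae_tendsto_average (hmem 0).toLp, hsum] with ω h1 h2
    simpa only [h2] using h1
  · exact condExpLp_eq_self_of_avgCondExp_eq_self hG
      (P.orthogonalProjectionOnto (hmem 0).toLp).2
  · intro s hs
    rw [MeasurableSpace.measurableSet_iInf] at hs
    have hs0 : MeasurableSet s := hG 0 s (hs 0)
    have hfix : indicatorConstLp 2 hs0 (measure_ne_top μ s) (1 : ℝ) ∈ P :=
      avgCondExp_eq_self hG fun n => condExpLp_indicatorConstLp (hG n) (hs n) 1
    rw [← L2.inner_indicatorConstLp_one (𝕜 := ℝ) hs0 (measure_ne_top μ s)]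
    have h1 : ∫ ω in s, F 0 ω ∂μ = ∫ ω in s, (hmem 0).toLp (F 0) ω ∂μ :=
      integral_congr_ae (ae_restrict_of_ae (hmem 0).coeFn_toLp.symm)
    rw [h1, ← L2.inner_indicatorConstLp_one (𝕜 := ℝ) hs0 (measure_ne_top μ s)]
    rw [← sub_eq_zero, ← inner_sub_right]
    exact P.sub_starProjection_mem_orthogonal (hmem 0).toLp _ hfix

end AvgCondExp

section Sufficient

variable {Ω Γ : Type*}

theorem IsSufficient.exists_bounded_condExp {G m0 : MeasurableSpace Ω} {P : Γ → Measure Ω}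
    (hP : ∀ γ, IsProbabilityMeasure (P γ)) (hG : IsSufficient m0 P G) {C : NNReal} {f : Ω → ℝ}
    (hf : Measurable f) (hfC : ∀ ω, |f ω| ≤ C) :
    ∃ g : Ω → ℝ, Measurable[G] g ∧ (∀ ω, |g ω| ≤ C) ∧ ∀ γ, g =ᵐ[P γ] (P γ)[f | G] := by
  obtain ⟨g, hg, hgi, hgs⟩ := hG.2 f hf ⟨C, hfC⟩
  refine ⟨fun ω => max (-C) (min C (g ω)), measurable_const.max (measurable_const.min hg),
    fun ω => abs_le.2 ⟨le_max_left _ _, max_le (by linarith [C.2]) (min_le_left _ _)⟩,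
    fun γ => ?_⟩
  have := hP γ
  have hfi : Integrable f (P γ) :=
    Integrable.of_bound hf.aestronglyMeasurable C (Eventually.of_forall hfC)
  have h1 : g =ᵐ[P γ] (P γ)[f | G] :=
    ae_eq_condExp_of_forall_setIntegral_eq hG.1 hfi (fun _ _ _ => (hgi γ).integrableOn)
      (fun s hs _ => (hgs γ s hs).symm) hg.stronglyMeasurable.aestronglyMeasurable
  filter_upwards [h1, ae_bdd_abs_condExp_of_ae_bdd_abs (m := G) (Eventually.of_forall hfC)] with ω h2 h3
  rw [← h2, abs_le] at h3
  rw [← h2, min_eq_right h3.2, max_eq_right h3.1]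

theorem measurable_of_forall_ae_eq {G m0 : MeasurableSpace Ω} {P : Γ → Measure Ω} (hG : G ≤ m0)
    (hN : MeasurableSpace.generateFrom {s : Set Ω | MeasurableSet s ∧ ∀ γ, P γ s = 0} ≤ G)
    {f g : Ω → ℝ} (hf : Measurable f) (hg : Measurable[G] g) (h : ∀ γ, f =ᵐ[P γ] g) :
    Measurable[G] f := by
  have hg0 : Measurable g := hg.mono hG le_rfl
  have hnull : ∀ s, MeasurableSet s → s ⊆ {ω | f ω ≠ g ω} → MeasurableSet[G] s :=
    fun s hs hsub => hN _ (MeasurableSpace.measurableSet_generateFrom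
      ⟨hs, fun γ => measure_mono_null hsub (h γ)⟩)
  intro B hB
  have e : f ⁻¹' B = (g ⁻¹' B \ (g ⁻¹' B \ f ⁻¹' B)) ∪ (f ⁻¹' B \ g ⁻¹' B) := by
    ext ω
    simp only [Set.mem_union, Set.mem_sdiff]
    tauto
  rw [e]
  refine ((hg hB).diff (hnull _ ((hg0 hB).diff (hf hB)) ?_)).union
    (hnull _ ((hf hB).diff (hg0 hB)) ?_)
  · rintro ω ⟨h1, h2⟩ heq
    exact h2 (by rwa [Set.mem_preimage, heq])
  · rintro ω ⟨h1, h2⟩ heq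
    exact h2 (by rwa [Set.mem_preimage, ← heq])

end Sufficient

/-- A countable collection of sufficient sub-σ-fields, each containing the σ-field
generated by the common null sets, has sufficient intersection. -/
theorem iInf_isSufficient
    {Ω Γ : Type*} (m0 : MeasurableSpace Ω) (P : Γ → @Measure Ω m0)
    (hP : ∀ γ, IsProbabilityMeasure (P γ))
    (G : ℕ → MeasurableSpace Ω)
    (hsuff : ∀ n, IsSufficient m0 P (G n))
    (hN : ∀ n, MeasurableSpace.generateFrom
        {s : Set Ω | MeasurableSet[m0] s ∧ ∀ γ, P γ s = 0} ≤ G n) :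
    IsSufficient m0 P (⨅ n, G n) := by
  have hle : ∀ n, G n ≤ m0 := fun n => (hsuff n).1
  refine ⟨(iInf_le G 0).trans (hle 0), fun f hf ⟨C₀, hC₀⟩ => ?_⟩
  obtain ⟨C, hfC⟩ : ∃ C : NNReal, ∀ ω, |f ω| ≤ C :=
    ⟨C₀.toNNReal, fun ω => (hC₀ ω).trans (Real.le_coe_toNNReal C₀)⟩
  choose τ hτm hτC hτ using fun (n : ℕ) (h : {h : Ω → ℝ // Measurable[m0] h ∧ ∀ ω, |h ω| ≤ C}) =>
    (hsuff n).exists_bounded_condExp hP h.2.1 h.2.2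
  have hτm0 : ∀ n h, Measurable[m0] (τ n h) := fun n h => (hτm n h).mono (hle n) le_rfl
  let step : {h : Ω → ℝ // Measurable[m0] h ∧ ∀ ω, |h ω| ≤ C} →
      {h : Ω → ℝ // Measurable[m0] h ∧ ∀ ω, |h ω| ≤ C} := fun h =>
    ⟨fun ω => ∑' n, ((1 : ℝ) / 2 / 2 ^ n) * τ n h ω,
      Measurable.tsum fun n => (hτm0 n h).const_mul _, fun ω => by
        have h1 := (hasSum_geometric_two' 1).mul_right (C : ℝ)
        rw [one_mul] at h1
        rw [← Real.norm_eq_abs]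
        refine tsum_of_norm_bounded h1 fun n => ?_
        rw [norm_mul, Real.norm_of_nonneg (by positivity)]
        gcongr
        exact hτC n h ω⟩
  let F : ℕ → {h : Ω → ℝ // Measurable[m0] h ∧ ∀ ω, |h ω| ≤ C} := fun k => step^[k] ⟨f, hf, hfC⟩
  let A : ℕ → Ω → ℝ := fun k ω => (k : ℝ)⁻¹ * ∑ i ∈ range k, (F i).1 ω
  have hAm : ∀ k, Measurable[m0] (A k) := fun k =>
    (Finset.measurable_sum _ fun i _ => (F i).2.1).const_mul _
  have hAC : ∀ k ω, |A k ω| ≤ C := fun k ω => by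
    have h1 : |∑ i ∈ range k, (F i).1 ω| ≤ k * C := by
      refine (abs_sum_le_sum_abs _ _).trans ((sum_le_sum fun i _ => (F i).2.2 ω).trans ?_)
      simp
    rw [abs_mul, abs_of_nonneg (by positivity), inv_mul_eq_div]
    exact div_le_of_le_mul₀ (by positivity) C.2 (by rwa [mul_comm])
  let g : {h : Ω → ℝ // Measurable[m0] h ∧ ∀ ω, |h ω| ≤ C} :=
    ⟨fun ω => max (-C) (min C (limsup (fun k => A k ω) atTop)),
      measurable_const.max (measurable_const.min (Measurable.limsup hAm)),
      fun ω => abs_le.2 ⟨le_max_left _ _, max_le (by linarith [C.2]) (min_le_left _ _)⟩⟩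
  have key : ∀ γ, ∃ p : Lp ℝ 2 (P γ), g.1 =ᵐ[P γ] p ∧ (∀ n, condExpLp (P γ) (hle n) p = p) ∧
      ∀ s, MeasurableSet[⨅ n, G n] s → ∫ ω in s, f ω ∂(P γ) = ∫ ω in s, p ω ∂(P γ) := by
    intro γ
    have := hP γ
    obtain ⟨p, hp, hfix, hint⟩ := exists_ae_tendsto_average_iterates (μ := P γ) hle
      (F := fun k => (F k).1) (t := fun k n => τ n (F k)) (fun k => (F k).2.1) (fun k => (F k).2.2)
      (fun k n => hτ n (F k) γ) (fun k n => hτC n (F k)) (fun k ω => by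
        simp only [F, Function.iterate_succ_apply']
        rfl)
    refine ⟨p, ?_, hfix, hint⟩
    filter_upwards [hp] with ω hω
    have hb : |p ω| ≤ C := le_of_tendsto hω.abs (Eventually.of_forall fun k => hAC k ω)
    have hl : limsup (fun k => A k ω) atTop = p ω := hω.limsup_eq
    rw [abs_le] at hb
    simp only [g, hl, min_eq_right hb.2, max_eq_right hb.1]
  have hgG : ∀ n, Measurable[G n] g.1 := fun n => by
    refine measurable_of_forall_ae_eq (hle n) (hN n) g.2.1 (hτm n g) fun γ => ?_
    have := hP γ
    obtain ⟨p, hgp, hfix, -⟩ := key γ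
    have h1 := condExpLp_ae_eq (hle n) p
    rw [hfix n] at h1
    exact hgp.trans (h1.trans ((condExp_congr_ae hgp.symm).trans (hτ n g γ).symm))
  refine ⟨g.1, fun B hB => ?_, fun γ => ?_, fun γ s hs => ?_⟩
  · rw [MeasurableSpace.measurableSet_iInf]
    exact fun n => hgG n hB
  · have := hP γ
    exact Integrable.of_bound g.2.1.aestronglyMeasurable C (Eventually.of_forall g.2.2)
  · obtain ⟨p, hgp, -, hint⟩ := key γ
    rw [hint s hs]
    exact integral_congr_ae (ae_restrict_of_ae hgp.symm)
end

section
/- There exist a measurable space $(\Omega, \mathcal{F})$, a family of probability measures $\{\mathbb{P}_\gamma\}_{\gamma \in \Gamma}$ on $\mathcal{F}$, and sub-$\sigma$-fields $\mathcal{G}_1, \mathcal{G}_2 \subseteq \mathcal{F}$ such that $\mathcal{G}_1$ and $\mathcal{G}_2$ are each sufficient, but the $\sigma$-field $\sigma(\mathcal{G}_1 \cup \mathcal{G}_2)$ generated by their union is not sufficient. -/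
open MeasureTheory

open Function MeasurableSpace
open scoped ENNReal

/-- If every measure of a family is invariant under a measurable involution `σ`, then the σ-field
of `σ`-invariant measurable sets is sufficient: `(f + f ∘ σ) / 2` is a version of `E[f | G]`. -/
theorem isSufficient_invariants {Ω Γ : Type*} [m0 : MeasurableSpace Ω] {P : Γ → Measure Ω}
    [∀ γ, IsProbabilityMeasure (P γ)] {σ : Ω → Ω} (hσ : Involutive σ)
    (hP : ∀ γ, MeasurePreserving σ (P γ) (P γ)) (hm : Measurable σ) :
    IsSufficient m0 P (invariants σ) := by
  refine ⟨invariants_le σ, fun f hf ⟨C, hC⟩ ↦ ?_⟩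
  have hfi (γ) : Integrable f (P γ) :=
    .of_bound hf.aestronglyMeasurable C (ae_of_all _ hC)
  have hfσ (γ) : Integrable (fun ω ↦ f (σ ω)) (P γ) :=
    .of_bound (hf.comp hm).aestronglyMeasurable C (ae_of_all _ fun ω ↦ hC (σ ω))
  refine ⟨fun ω ↦ (f ω + f (σ ω)) / 2, ?_, fun γ ↦ ((hfi γ).add (hfσ γ)).div_const 2,
    fun γ s hs ↦ ?_⟩
  · refine measurable_invariants_dom.2 ⟨(hf.add (hf.comp hm)).div_const 2, fun s _ ↦ ?_⟩
    ext ω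
    simp [hσ ω, add_comm]
  · have h : ∫ ω in s, f ω ∂(P γ) = ∫ ω in s, f (σ ω) ∂(P γ) := by
      have := setIntegral_map (μ := P γ) (g := σ) hs.1 (f := f) hf.aestronglyMeasurable
        hm.aemeasurable
      rwa [(hP γ).map_eq, hs.2] at this
    rw [integral_div, integral_add (hfi γ).integrableOn (hfσ γ).integrableOn, ← h]
    ring

namespace TwoSheets

variable {T : Type*}

/-- The σ-field on two copies of `T` consisting of the sets that are countable or co-countable
on each copy. -/
@[reducible]
def sheetwiseCocountable (T : Type*) : MeasurableSpace (T × Bool) where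
  MeasurableSet' s := ∃ S : Set Bool, {x | ¬(x ∈ s ↔ x.2 ∈ S)}.Countable
  measurableSet_empty := ⟨∅, by simp⟩
  measurableSet_compl := fun s ⟨S, hS⟩ ↦ ⟨Sᶜ, by simpa [not_iff_not] using hS⟩
  measurableSet_iUnion s hs := by
    choose S hS using hs
    refine ⟨⋃ i, S i, (Set.countable_iUnion hS).mono fun x hx ↦ ?_⟩
    simp only [Set.mem_iUnion, Set.mem_ofPred_eq] at hx ⊢
    by_contra! h
    exact hx (exists_congr h)

attribute [local instance] sheetwiseCocountable

theorem measurableSet_iff {s : Set (T × Bool)} :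
    MeasurableSet s ↔ ∃ S : Set Bool, {x | ¬(x ∈ s ↔ x.2 ∈ S)}.Countable :=
  Iff.rfl

instance : MeasurableSingletonClass (T × Bool) where
  measurableSet_singleton x :=
    measurableSet_iff.2 ⟨∅, by simp⟩

theorem measurableSet_preimage_snd (S : Set Bool) :
    MeasurableSet (Prod.snd ⁻¹' S : Set (T × Bool)) :=
  measurableSet_iff.2 ⟨S, by simp⟩

/-- On each sheet, one of a measurable set and its complement is countable. -/
theorem countable_or_countable_compl {s : Set (T × Bool)} (hs : MeasurableSet s) (b : Bool) :
    {t | (t, b) ∈ s}.Countable ∨ {t | (t, b) ∉ s}.Countable := by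
  obtain ⟨S, hS⟩ := measurableSet_iff.1 hs
  have := hS.preimage (Prod.mk_left_injective b)
  by_cases hb : b ∈ S
  · exact .inr <| by simpa [Set.preimage, hb] using this
  · exact .inl <| by simpa [Set.preimage, hb] using this

/-- The map that acts by `φ` on `T` and exchanges the two sheets. -/
def flip (φ : T → T) (x : T × Bool) : T × Bool := (φ x.1, !x.2)

theorem flip_involutive {φ : T → T} (hφ : Involutive φ) : Involutive (flip φ) := by
  rintro ⟨t, b⟩
  simp [flip, hφ t]

theorem measurable_flip {φ : T → T} (hφ : Involutive φ) : Measurable (flip φ) := by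
  rintro s ⟨S, hS⟩
  refine ⟨Bool.not ⁻¹' S, ?_⟩
  exact hS.preimage (flip_involutive hφ).injective

/-- The uniform measure on the pairs `(t, b)` and `(φ t, b)`. -/
noncomputable def orbitMeasure (φ : T → T) (t : T) : Measure (T × Bool) :=
  (4⁻¹ : ℝ≥0∞) • ((Measure.dirac (t, true) + Measure.dirac (t, false)) +
    (Measure.dirac (φ t, true) + Measure.dirac (φ t, false)))

instance (φ : T → T) (t : T) : IsProbabilityMeasure (orbitMeasure φ t) := by
  constructor
  simp only [orbitMeasure, Measure.smul_apply, Measure.add_apply, measure_univ, smul_eq_mul]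
  rw [show (1 + 1 + (1 + 1) : ℝ≥0∞) = 4 by norm_num]
  exact ENNReal.inv_mul_cancel (by simp) (by simp)

theorem integral_orbitMeasure (φ : T → T) (t : T) (f : T × Bool → ℝ) :
    ∫ x, f x ∂(orbitMeasure φ t) =
      4⁻¹ * ((f (t, true) + f (t, false)) + (f (φ t, true) + f (φ t, false))) := by
  have hi (x : T × Bool) : Integrable f (Measure.dirac x) := integrable_dirac (by simp)
  rw [orbitMeasure, integral_smul_measure, integral_add_measure ((hi _).add_measure (hi _))
    ((hi _).add_measure (hi _)), integral_add_measure (hi _) (hi _),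
    integral_add_measure (hi _) (hi _)]
  simp [integral_dirac]

theorem measurePreserving_flip_id (φ : T → T) (t : T) :
    MeasurePreserving (flip id) (orbitMeasure φ t) (orbitMeasure φ t) := by
  have hm : Measurable (flip (id : T → T)) := measurable_flip fun _ ↦ rfl
  refine ⟨hm, ?_⟩
  simp only [orbitMeasure, Measure.map_smul, Measure.map_add _ _ hm, Measure.map_dirac' hm, flip,
    id, Bool.not_true, Bool.not_false]
  congr 1
  abel

theorem measurePreserving_flip {φ : T → T} (hφ : Involutive φ) (t : T) :
    MeasurePreserving (flip φ) (orbitMeasure φ t) (orbitMeasure φ t) := by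
  have hm := measurable_flip hφ
  refine ⟨hm, ?_⟩
  simp only [orbitMeasure, Measure.map_smul, Measure.map_add _ _ hm, Measure.map_dirac' hm, flip,
    hφ t, Bool.not_true, Bool.not_false]
  congr 1
  abel

theorem measurableSet_pair {φ : T → T} (hφ : Involutive φ) (x : T × Bool) :
    MeasurableSet[invariants (flip φ)] {x, flip φ x} := by
  refine measurableSet_invariants.2 ⟨(Set.toFinite _).measurableSet, ?_⟩
  ext y
  simp [(flip_involutive hφ).eq_iff, flip_involutive hφ x, or_comm]

theorem measurableSet_sup_singleton {φ : T → T} (hφ : Involutive φ) {x : T × Bool}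
    (hx : φ x.1 ≠ x.1) :
    MeasurableSet[invariants (flip id) ⊔ invariants (flip φ)] {x} := by
  have h₁ := le_sup_left (b := invariants (flip φ)) _ (measurableSet_pair (φ := id) (fun _ ↦ rfl) x)
  have h₂ := le_sup_right (a := invariants (flip (id : T → T))) _ (measurableSet_pair hφ x)
  convert h₁.inter h₂ using 1
  obtain ⟨t, b⟩ := x
  ext ⟨u, c⟩
  simp only [flip, id, Set.mem_inter_iff, Set.mem_insert_iff, Set.mem_singleton_iff, Prod.mk.injEq]
  grind

/-- A function measurable with respect to `σ(G₁ ∪ G₂)` does not separate the sheets over a fixed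
point of `φ`. -/
theorem apply_true_eq_apply_false {φ : T → T} {t : T} (ht : φ t = t) {g : T × Bool → ℝ}
    (hg : Measurable[invariants (flip id) ⊔ invariants (flip φ)] g) :
    g (t, true) = g (t, false) := by
  classical
  let τ (x : T × Bool) : T × Bool := if φ x.1 = x.1 then (x.1, !x.2) else x
  have hle : invariants (flip id) ⊔ invariants (flip φ) ≤ @invariants (T × Bool) ⊤ τ := by
    refine sup_le ?_ ?_ <;>
    · rintro s ⟨-, hs⟩
      refine ⟨trivial, ?_⟩
      ext x
      by_cases hx : φ x.1 = x.1
      · conv_rhs => rw [← hs]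
        simp [τ, flip, hx]
      · simp [τ, hx]
  have := congrFun (@comp_eq_of_measurable_invariants _ ⊤ _ _ _ _ _ (hg.mono hle le_rfl))
    (t, true)
  simpa [τ, ht] using this.symm

theorem not_isSufficient_sup {φ : T → T} (hφ : Involutive φ)
    (hfix : ¬ {t | φ t = t}.Countable) (hmove : ¬ {t | φ t ≠ t}.Countable) :
    ¬ IsSufficient (sheetwiseCocountable T) (orbitMeasure φ)
      (invariants (flip id) ⊔ invariants (flip φ)) := by
  rintro ⟨hle, h⟩
  obtain ⟨g, hg, -, hfg⟩ := h ((Prod.snd ⁻¹' {true}).indicator 1)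
    (measurable_one.indicator (measurableSet_preimage_snd _))
    ⟨1, fun x ↦ by by_cases hx : x.2 = true <;> simp [Set.indicator, hx]⟩
  have hmoved {t : T} (ht : φ t ≠ t) : g (t, true) = 1 := by
    have hs := measurableSet_sup_singleton hφ (x := (t, true)) ht
    have := hfg t _ hs
    rw [← integral_indicator (hle _ hs), ← integral_indicator (hle _ hs),
      integral_orbitMeasure, integral_orbitMeasure] at this
    have hne : (φ t, true) ∉ ({(t, true)} : Set (T × Bool)) := by simpa using ht
    simpa [Set.indicator, hne, eq_comm] using this
  have hfixed {t : T} (ht : φ t = t) : g (t, true) ≠ 1 := by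
    have := hfg t Set.univ MeasurableSet.univ
    rw [setIntegral_univ, setIntegral_univ, integral_orbitMeasure, integral_orbitMeasure, ht,
      ← apply_true_eq_apply_false ht hg] at this
    simp [Set.indicator] at this
    intro h
    rw [h] at this
    norm_num at this
  have hmem (t : T) : (t, true) ∈ g ⁻¹' {1} ↔ φ t ≠ t :=
    ⟨fun h ht ↦ hfixed ht h, fun h ↦ hmoved h⟩
  have := countable_or_countable_compl (hle _ (hg (measurableSet_singleton 1))) true
  simp only [hmem, ne_eq, not_not] at this
  exact this.elim hmove hfix

end TwoSheets

open TwoSheets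

/-- There exist a measurable space, a family of probability measures, and two sufficient
sub-σ-fields whose generated union σ-field is not sufficient. -/
theorem exists_sufficient_pair_sup_not_sufficient :
    ∃ (Ω : Type) (m0 : MeasurableSpace Ω) (Γ : Type) (P : Γ → @Measure Ω m0),
      (∀ γ, IsProbabilityMeasure (P γ)) ∧
      ∃ G1 G2 : MeasurableSpace Ω,
        IsSufficient m0 P G1 ∧ IsSufficient m0 P G2 ∧
        ¬ IsSufficient m0 P (G1 ⊔ G2) := by
  let φ (t : Fin 3 × ℝ) : Fin 3 × ℝ := (Equiv.swap 0 1 t.1, t.2)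
  have hφ : Involutive φ := fun t ↦ by simp [φ]
  have huncountable (i : Fin 3) {s : Set (Fin 3 × ℝ)} (hs : ∀ r, (i, r) ∈ s) :
      ¬ s.Countable := fun h ↦ by
    have := h.preimage (Prod.mk_right_injective i)
    rw [Set.eq_univ_of_forall (s := Prod.mk i ⁻¹' s) hs] at this
    exact Set.not_countable_univ this
  refine ⟨(Fin 3 × ℝ) × Bool, sheetwiseCocountable _, Fin 3 × ℝ, orbitMeasure φ, inferInstance,
    @invariants _ (sheetwiseCocountable _) (flip id),
    @invariants _ (sheetwiseCocountable _) (flip φ), ?_, ?_, ?_⟩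
  · exact isSufficient_invariants (m0 := sheetwiseCocountable _) (flip_involutive fun _ ↦ rfl) (measurePreserving_flip_id φ)
      (measurable_flip fun _ ↦ rfl)
  · exact isSufficient_invariants (m0 := sheetwiseCocountable _) (flip_involutive hφ) (measurePreserving_flip hφ)
      (measurable_flip hφ)
  · refine not_isSufficient_sup hφ (huncountable 2 fun r ↦ ?_) (huncountable 0 fun r ↦ ?_)
    · simp [φ, Equiv.swap_apply_of_ne_of_ne]
    · simp [φ]
end
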